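/- For every real Δ > 0, the function s ↦ F(s,Δ) is complex-differentiable (holomorphic) at every point of ℂ \ {0, 1}; hence it provides the analytic continuation of (Δ/π)^s Γ(s) ζ⁽²⁾(s,Δ) to the whole complex plane except s = 0 and s = 1. -/

import Mathlib

open MeasureTheory

/-- The Jacobi theta function `θ₃(q) = Σ_{j∈ℤ} q^{j²}`. -/
noncomputable def theta3 (q : ℝ) : ℝ := ∑' j : ℤ, q ^ (j ^ 2)

/-- The two-dimensional Epstein zeta function on the rectangular lattice with
spacings `1` and `Δ`:  `ζ⁽²⁾(s,Δ) = (1/2) Σ'_{(j,k)≠(0,0)} (j² + Δ²k²)^(-s)`. -/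
noncomputable def epsteinZeta2 (s : ℂ) (Δ : ℝ) : ℂ :=
  (1 / 2) * ∑' p : {p : ℤ × ℤ // p ≠ 0},
    (((p.1.1 : ℝ) ^ 2 + Δ ^ 2 * (p.1.2 : ℝ) ^ 2 : ℝ) : ℂ) ^ (-s)

/-- The analytic continuation
`F(s,Δ) = -(1/2)(1/(1-s) + 1/s)
   + (1/2)∫₀¹ (t^{s-1} + t^{-s}) (θ₃(e^{-πtΔ}) θ₃(e^{-πt/Δ}) - 1/t) dt`. -/
noncomputable def F (s : ℂ) (Δ : ℝ) : ℂ :=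
  -(1 / 2) * (1 / (1 - s) + 1 / s) +
    (1 / 2) * ∫ t in Set.Ioo (0 : ℝ) 1,
      ((t : ℂ) ^ (s - 1) + (t : ℂ) ^ (-s)) *
        ((theta3 (Real.exp (-(Real.pi * t * Δ))) *
            theta3 (Real.exp (-(Real.pi * t / Δ))) - 1 / t : ℝ) : ℂ)

open HurwitzZeta in
/-- The even Hurwitz kernel at `0` is the theta function `θ₃(e^{-πt})`. -/
lemma theta3_exp_neg_pi_mul {t : ℝ} (ht : 0 < t) :
    theta3 (Real.exp (-(Real.pi * t))) = evenKernel 0 t := by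
  have h := (hasSum_int_evenKernel 0 ht).tsum_eq
  simp only [QuotientAddGroup.mk_zero, add_zero] at h
  rw [← h, theta3]
  congr 1 with n
  rw [← Real.rpow_intCast, ← Real.exp_mul]
  push_cast
  ring_nf

/-- The rectangular lattice theta function, as a product of two one-dimensional kernels. -/
noncomputable def latticeTheta (Δ t : ℝ) : ℝ :=
  HurwitzZeta.evenKernel 0 (t * Δ) * HurwitzZeta.evenKernel 0 (t / Δ)

lemma latticeTheta_eq_theta3 {Δ t : ℝ} (hΔ : 0 < Δ) (ht : 0 < t) :
    latticeTheta Δ t = theta3 (Real.exp (-(Real.pi * t * Δ))) *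
      theta3 (Real.exp (-(Real.pi * t / Δ))) := by
  rw [latticeTheta, ← theta3_exp_neg_pi_mul (mul_pos ht hΔ),
    ← theta3_exp_neg_pi_mul (div_pos ht hΔ), mul_assoc, mul_div_assoc]

lemma continuousOn_latticeTheta {Δ : ℝ} (hΔ : 0 < Δ) :
    ContinuousOn (latticeTheta Δ) (Set.Ioi 0) := by
  refine ContinuousOn.mul ?_ ?_
  · exact (HurwitzZeta.continuousOn_evenKernel 0).comp (by fun_prop)
      fun t (ht : 0 < t) => mul_pos ht hΔ
  · exact (HurwitzZeta.continuousOn_evenKernel 0).comp (by fun_prop)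
      fun t (ht : 0 < t) => div_pos ht hΔ

lemma latticeTheta_one_div {Δ x : ℝ} (hΔ : 0 < Δ) (hx : 0 < x) :
    latticeTheta Δ (1 / x) = x * latticeTheta Δ x := by
  have h (y : ℝ) (hy : 0 < y) : HurwitzZeta.evenKernel 0 (1 / y) =
      √y * HurwitzZeta.evenKernel 0 y := by
    have := HurwitzZeta.evenKernel_functional_equation 0 (1 / y)
    rw [one_div_one_div, ← HurwitzZeta.evenKernel_eq_cosKernel_of_zero, ← Real.sqrt_eq_rpow,
      one_div, Real.sqrt_inv, one_div, inv_inv] at this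
    rwa [one_div]
  have e1 : 1 / x * Δ = 1 / (x / Δ) := by field_simp
  have e2 : 1 / x / Δ = 1 / (x * Δ) := by field_simp
  rw [latticeTheta, latticeTheta, e1, e2, h _ (by positivity), h _ (by positivity)]
  have : √(x / Δ) * √(x * Δ) = x := by
    rw [← Real.sqrt_mul (by positivity), show x / Δ * (x * Δ) = x ^ 2 by field_simp,
      Real.sqrt_sq hx.le]
  linear_combination (HurwitzZeta.evenKernel 0 (x / Δ) * HurwitzZeta.evenKernel 0 (x * Δ)) * this

open Filter Asymptotics in
lemma isBigO_evenKernel_zero_comp_mul_sub_one {c : ℝ} (hc : 0 < c) (r : ℝ) :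
    (fun x => HurwitzZeta.evenKernel 0 (x * c) - 1) =O[atTop] (fun x : ℝ => x ^ r) := by
  obtain ⟨p, hp, h⟩ := HurwitzZeta.isBigO_atTop_evenKernel_sub 0
  simp only [if_true] at h
  have h1 := h.comp_tendsto (tendsto_id.atTop_mul_const hc)
  refine h1.trans ?_
  have h2 := (isLittleO_exp_neg_mul_rpow_atTop (mul_pos hp hc) r).isBigO
  refine h2.congr_left fun x => ?_
  simp only [Function.comp_apply, id]
  ring_nf

open Filter Asymptotics in
lemma isBigO_latticeTheta_sub_one {Δ : ℝ} (hΔ : 0 < Δ) (r : ℝ) :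
    (fun x => latticeTheta Δ x - 1) =O[atTop] (fun x : ℝ => x ^ r) := by
  have h1 (r : ℝ) := isBigO_evenKernel_zero_comp_mul_sub_one hΔ r
  have h2 (r : ℝ) := isBigO_evenKernel_zero_comp_mul_sub_one (inv_pos.2 hΔ) r
  have h3 := (h1 0).mul (h2 r)
  simp only [Real.rpow_zero, one_mul] at h3
  refine ((h3.add (h1 r)).add (h2 r)).congr_left fun x => ?_
  rw [latticeTheta, div_eq_mul_inv]
  ring

/-- The functional-equation pair attached to the rectangular lattice theta function. -/
noncomputable def latticeFEPair (Δ : ℝ) (hΔ : 0 < Δ) : WeakFEPair ℂ where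
  f t := latticeTheta Δ t
  g t := latticeTheta Δ t
  k := 1
  ε := 1
  f₀ := 1
  g₀ := 1
  hf_int := (Complex.continuous_ofReal.comp_continuousOn
    (continuousOn_latticeTheta hΔ)).locallyIntegrableOn measurableSet_Ioi
  hg_int := (Complex.continuous_ofReal.comp_continuousOn
    (continuousOn_latticeTheta hΔ)).locallyIntegrableOn measurableSet_Ioi
  hk := one_pos
  hε := one_ne_zero
  h_feq x hx := by simp only [latticeTheta_one_div hΔ hx]; simp
  hf_top r := by
    rw [← Asymptotics.isBigO_norm_left]
    refine (isBigO_latticeTheta_sub_one hΔ r).norm_left.congr_left fun x => ?_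
    rw [← Complex.norm_real]
    push_cast
    rfl
  hg_top r := by
    rw [← Asymptotics.isBigO_norm_left]
    refine (isBigO_latticeTheta_sub_one hΔ r).norm_left.congr_left fun x => ?_
    rw [← Complex.norm_real]
    push_cast
    rfl

/-- The part of the modified kernel of a lattice FE-pair that is supported on `(0, 1)`. -/
noncomputable def latticeThetaNearZero (Δ : ℝ) : ℝ → ℂ :=
  (Set.Ioo 0 1).indicator fun t => ((latticeTheta Δ t - 1 / t : ℝ) : ℂ)

lemma f_modif_latticeFEPair {Δ : ℝ} (hΔ : 0 < Δ) {t : ℝ} (ht : 0 < t) :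
    (latticeFEPair Δ hΔ).f_modif t = latticeThetaNearZero Δ t +
      (t : ℂ) ^ (-1 : ℂ) • latticeThetaNearZero Δ t⁻¹ := by
  have h1 : latticeTheta Δ t⁻¹ = t * latticeTheta Δ t := by
    rw [← one_div, latticeTheta_one_div hΔ ht]
  have ht' : (t : ℂ) ≠ 0 := mod_cast ht.ne'
  rcases lt_trichotomy t 1 with h | rfl | h
  · have : ¬ t⁻¹ < 1 := by simpa using (one_lt_inv₀ ht).2 h |>.le
    simp [WeakFEPair.f_modif, latticeFEPair, latticeThetaNearZero, Set.indicator, h, ht, h.le,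
      this, Real.rpow_neg_one]
  · simp [WeakFEPair.f_modif, latticeThetaNearZero]
  · have : t⁻¹ < 1 := inv_lt_one_of_one_lt₀ h
    simp [WeakFEPair.f_modif, latticeFEPair, latticeThetaNearZero, Set.indicator, h, ht,
      this, h.not_gt, h1, Complex.cpow_neg_one]
    field_simp

lemma mellinConvergent_latticeThetaNearZero {Δ : ℝ} (hΔ : 0 < Δ) (s : ℂ) :
    MellinConvergent (latticeThetaNearZero Δ) s := by
  have h : MellinConvergent (latticeFEPair Δ hΔ).f_modif s :=
    ((latticeFEPair Δ hΔ).isStrongFEPair_toStrongFEPair.hasMellin s).1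
  have h' := (h.mono_set fun (t : ℝ) (ht : t ∈ Set.Ioo 0 1) => ht.1).integrable_indicator
    measurableSet_Ioo
  refine h'.integrableOn.congr_fun (fun t (ht : 0 < t) => ?_) measurableSet_Ioi
  by_cases h1 : t < 1
  · simp [WeakFEPair.f_modif, latticeFEPair, latticeThetaNearZero, Set.indicator, ht, h1,
      h1.le, Real.rpow_neg_one]
  · simp [latticeThetaNearZero, Set.indicator, h1]

lemma mellin_latticeThetaNearZero (Δ : ℝ) (s : ℂ) :
    mellin (latticeThetaNearZero Δ) s = ∫ t in Set.Ioo (0 : ℝ) 1,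
      (t : ℂ) ^ (s - 1) * ((latticeTheta Δ t - 1 / t : ℝ) : ℂ) := by
  simp_rw [mellin, latticeThetaNearZero, ← Set.indicator_smul,
    setIntegral_indicator measurableSet_Ioo,
    Set.inter_eq_right.mpr Set.Ioo_subset_Ioi_self, smul_eq_mul]

lemma integrableOn_cpow_mul_latticeTheta_sub {Δ : ℝ} (hΔ : 0 < Δ) (s : ℂ) :
    IntegrableOn (fun t : ℝ => (t : ℂ) ^ (s - 1) * ((latticeTheta Δ t - 1 / t : ℝ) : ℂ))
      (Set.Ioo 0 1) := by
  refine ((mellinConvergent_latticeThetaNearZero hΔ s).mono_set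
    Set.Ioo_subset_Ioi_self).congr_fun (fun t ht => ?_) measurableSet_Ioo
  simp only [latticeThetaNearZero, Set.indicator_of_mem ht, smul_eq_mul]

lemma latticeFEPair_Λ₀ {Δ : ℝ} (hΔ : 0 < Δ) (s : ℂ) :
    (latticeFEPair Δ hΔ).Λ₀ s =
      mellin (latticeThetaNearZero Δ) s + mellin (latticeThetaNearZero Δ) (1 - s) := by
  have hinv : MellinConvergent
      (fun t : ℝ => (t : ℂ) ^ (-1 : ℂ) • latticeThetaNearZero Δ t⁻¹) s := by
    rw [MellinConvergent.cpow_smul]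
    have := (MellinConvergent.comp_rpow (f := latticeThetaNearZero Δ) (s := s + -1)
      (a := -1) (by norm_num)).2 (mellinConvergent_latticeThetaNearZero hΔ _)
    simpa only [Real.rpow_neg_one] using this
  have hadd := (hasMellin_add (mellinConvergent_latticeThetaNearZero hΔ s) hinv).2
  rw [mellin_cpow_smul, mellin_comp_inv, show -(s + -1) = 1 - s by ring] at hadd
  rw [← hadd, WeakFEPair.Λ₀]
  refine setIntegral_congr_fun measurableSet_Ioi fun t ht => ?_
  simp only [f_modif_latticeFEPair hΔ ht]

lemma F_eq_latticeFEPair_Λ {Δ : ℝ} (hΔ : 0 < Δ) (s : ℂ) :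
    F s Δ = (1 / 2) * (latticeFEPair Δ hΔ).Λ s := by
  have hint : (∫ t in Set.Ioo (0 : ℝ) 1, ((t : ℂ) ^ (s - 1) + (t : ℂ) ^ (-s)) *
      ((theta3 (Real.exp (-(Real.pi * t * Δ))) *
        theta3 (Real.exp (-(Real.pi * t / Δ))) - 1 / t : ℝ) : ℂ)) =
      (latticeFEPair Δ hΔ).Λ₀ s := by
    rw [latticeFEPair_Λ₀, mellin_latticeThetaNearZero, mellin_latticeThetaNearZero,
      ← integral_add (integrableOn_cpow_mul_latticeTheta_sub hΔ s)
        (integrableOn_cpow_mul_latticeTheta_sub hΔ (1 - s))]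
    refine setIntegral_congr_fun measurableSet_Ioo fun t ht => ?_
    simp only [latticeTheta_eq_theta3 hΔ ht.1, show 1 - s - 1 = -s by ring, add_mul]
  rw [F, hint, WeakFEPair.Λ]
  simp only [latticeFEPair, smul_eq_mul, mul_one, Complex.ofReal_one]
  ring

/-- The quadratic form attached to the rectangular lattice, normalised to determinant one. -/
noncomputable def latticeForm (Δ : ℝ) (x : ℤ × ℤ) : ℝ :=
  ((x.1 : ℝ) ^ 2 + Δ ^ 2 * (x.2 : ℝ) ^ 2) / Δ

lemma latticeForm_nonneg {Δ : ℝ} (hΔ : 0 < Δ) (x : ℤ × ℤ) : 0 ≤ latticeForm Δ x := by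
  unfold latticeForm
  positivity

lemma latticeForm_eq_zero_iff {Δ : ℝ} (hΔ : 0 < Δ) {x : ℤ × ℤ} :
    latticeForm Δ x = 0 ↔ x = 0 := by
  constructor
  · intro h
    rw [latticeForm, div_eq_zero_iff, or_iff_left hΔ.ne',
      add_eq_zero_iff_of_nonneg (by positivity) (by positivity)] at h
    ext
    · simpa using h.1
    · simpa [hΔ.ne'] using h.2
  · rintro rfl
    simp [latticeForm]

lemma hasSum_latticeTheta {Δ t : ℝ} (hΔ : 0 < Δ) (ht : 0 < t) :
    HasSum (fun x => Real.exp (-Real.pi * latticeForm Δ x * t)) (latticeTheta Δ t) := by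
  have h1 := HurwitzZeta.hasSum_int_evenKernel 0 (mul_pos ht hΔ)
  have h2 := HurwitzZeta.hasSum_int_evenKernel 0 (div_pos ht hΔ)
  have h := h2.mul h1 (h2.summable.mul_of_nonneg h1.summable
    (fun _ => (Real.exp_pos _).le) (fun _ => (Real.exp_pos _).le))
  rw [latticeTheta, mul_comm]
  refine h.congr_fun fun x => ?_
  rw [← Real.exp_add, latticeForm]
  congr 1
  field_simp
  ring

lemma mul_norm_sq_le_latticeForm {Δ : ℝ} (hΔ : 0 < Δ) (x : ℤ × ℤ) :
    min Δ Δ⁻¹ * ‖x‖ ^ 2 ≤ latticeForm Δ x := by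
  have hc : 0 < min Δ Δ⁻¹ := by positivity
  have e : latticeForm Δ x = Δ⁻¹ * (x.1 : ℝ) ^ 2 + Δ * (x.2 : ℝ) ^ 2 := by
    rw [latticeForm]
    field_simp
  rw [e, Prod.norm_def]
  rcases max_choice ‖x.1‖ ‖x.2‖ with h | h <;> rw [h, Int.norm_eq_abs, sq_abs]
  · have := mul_le_mul_of_nonneg_right (min_le_right Δ Δ⁻¹) (sq_nonneg (x.1 : ℝ))
    have : 0 ≤ Δ * (x.2 : ℝ) ^ 2 := by positivity
    linarith
  · have := mul_le_mul_of_nonneg_right (min_le_left Δ Δ⁻¹) (sq_nonneg (x.2 : ℝ))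
    have : 0 ≤ Δ⁻¹ * (x.1 : ℝ) ^ 2 := by positivity
    linarith

lemma summable_one_div_latticeForm_rpow {Δ σ : ℝ} (hΔ : 0 < Δ) (hσ : 1 < σ) :
    Summable fun x => 1 / latticeForm Δ x ^ σ := by
  have hc : 0 < min Δ Δ⁻¹ := by positivity
  have h := (finTwoArrowEquiv ℤ).symm.summable_iff.2
    (EisensteinSeries.summable_one_div_norm_rpow (k := 2 * σ) (by linarith))
  refine (h.mul_left ((min Δ Δ⁻¹) ^ σ)⁻¹).of_nonneg_of_le
    (fun x => by have := latticeForm_nonneg hΔ x; positivity) fun x => ?_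
  rcases eq_or_ne x 0 with rfl | hx
  · rw [(latticeForm_eq_zero_iff hΔ).2 rfl, Real.zero_rpow (by linarith), div_zero]
    exact mul_nonneg (by positivity) (Real.rpow_nonneg (norm_nonneg _) _)
  have hn : ‖(finTwoArrowEquiv ℤ).symm x‖ = ‖x‖ := by
    rw [EisensteinSeries.norm_eq_max_natAbs, Prod.norm_def]
    simp [Int.norm_eq_abs, Nat.cast_natAbs]
  have hx' : 0 < ‖x‖ := norm_pos_iff.2 hx
  rw [Function.comp_apply, hn, Real.rpow_neg hx'.le, ← mul_inv, one_div, Real.rpow_mul hx'.le,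
    Real.rpow_two, ← Real.mul_rpow hc.le (by positivity)]
  gcongr
  exact mul_norm_sq_le_latticeForm hΔ x

lemma hasSum_latticeFEPair_Λ {Δ : ℝ} (hΔ : 0 < Δ) {s : ℂ} (hs : 1 < s.re) :
    HasSum (fun x => (Real.pi : ℂ) ^ (-s) * Complex.Gamma s * 1 / (latticeForm Δ x : ℂ) ^ s)
      ((latticeFEPair Δ hΔ).Λ s) := by
  rw [← ((latticeFEPair Δ hΔ).hasMellin hs).2]
  refine hasSum_mellin_pi_mul₀ (a := fun _ => 1) (latticeForm_nonneg hΔ) (by linarith)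
    (fun t ht => ?_) ?_
  · have h := hasSum_ite_sub_hasSum
      (Complex.hasSum_ofReal.2 (hasSum_latticeTheta hΔ (Set.mem_Ioi.1 ht))) 0
    simp only [(latticeForm_eq_zero_iff hΔ).2 rfl, mul_zero, zero_mul, Real.exp_zero,
      Complex.ofReal_one] at h
    simp only [latticeForm_eq_zero_iff hΔ, one_mul]
    convert! h using 1
  · simpa using summable_one_div_latticeForm_rpow hΔ hs

lemma latticeFEPair_Λ_eq_epsteinZeta2 {Δ : ℝ} (hΔ : 0 < Δ) {s : ℂ} (hs : 1 < s.re) :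
    (1 / 2) * (latticeFEPair Δ hΔ).Λ s =
      ((Δ / Real.pi : ℝ) : ℂ) ^ s * Complex.Gamma s * epsteinZeta2 s Δ := by
  have hs0 : s ≠ 0 := by
    rintro rfl
    norm_num at hs
  have hsum := hasSum_latticeFEPair_Λ hΔ hs
  have hsupp : Function.support (fun x => (Real.pi : ℂ) ^ (-s) * Complex.Gamma s * 1 /
      (latticeForm Δ x : ℂ) ^ s) ⊆ {x : ℤ × ℤ | x ≠ 0} := by
    intro x hx h0
    subst h0
    exact hx (by simp [(latticeForm_eq_zero_iff hΔ).2 rfl, hs0])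
  rw [← hsum.tsum_eq, ← tsum_subtype_eq_of_support_subset hsupp, epsteinZeta2,
    mul_left_comm (_ * _) (1 / 2 : ℂ),
    ← tsum_mul_left (a := ((Δ / Real.pi : ℝ) : ℂ) ^ s * Complex.Gamma s)]
  refine congrArg ((1 / 2 : ℂ) * ·) (tsum_congr (β := {p : ℤ × ℤ // p ≠ 0}) fun x => ?_)
  have hq : 0 ≤ (x.1.1 : ℝ) ^ 2 + Δ ^ 2 * (x.1.2 : ℝ) ^ 2 := by positivity
  rw [latticeForm, div_eq_mul_inv _ Δ, div_eq_mul_inv Δ, Complex.ofReal_mul, Complex.ofReal_mul,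
    Complex.mul_cpow_ofReal_nonneg hq (by positivity),
    Complex.mul_cpow_ofReal_nonneg hΔ.le (by positivity), Complex.cpow_neg, Complex.cpow_neg,
    Complex.ofReal_inv, Complex.ofReal_inv,
    Complex.inv_cpow _ _ (by rw [Complex.arg_ofReal_of_nonneg hΔ.le]; exact Real.pi_pos.ne),
    Complex.inv_cpow _ _ (by
      rw [Complex.arg_ofReal_of_nonneg Real.pi_pos.le]; exact Real.pi_pos.ne)]
  rw [mul_one, div_eq_mul_inv, mul_inv, inv_inv]
  ring

/-- for every `Δ > 0`, `s ↦ F(s,Δ)` is complex-differentiable at every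
point of `ℂ \ {0,1}`; hence, since `F(s,Δ) = (Δ/π)^s Γ(s) ζ⁽²⁾(s,Δ)` for `Re s > 1`,
it provides the analytic continuation of `(Δ/π)^s Γ(s) ζ⁽²⁾(s,Δ)` to `ℂ \ {0,1}`. -/
theorem F_differentiable (Δ : ℝ) (hΔ : 0 < Δ) :
    (∀ s : ℂ, s ≠ 0 → s ≠ 1 → DifferentiableAt ℂ (fun z => F z Δ) s) ∧
    (∀ s : ℂ, 1 < s.re →
      F s Δ = ((Δ / Real.pi : ℝ) : ℂ) ^ s * Complex.Gamma s * epsteinZeta2 s Δ) := by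
  refine ⟨fun s hs0 hs1 => ?_, fun s hs => ?_⟩
  · simp only [F_eq_latticeFEPair_Λ hΔ]
    refine DifferentiableAt.const_mul ?_ _
    exact (latticeFEPair Δ hΔ).differentiableAt_Λ (Or.inl hs0)
      (Or.inl (by simpa [latticeFEPair] using hs1))
  · rw [F_eq_latticeFEPair_Λ hΔ, latticeFEPair_Λ_eq_epsteinZeta2 hΔ hs]
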